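/- arXiv:2309.05547 — 2 statements merged into one kernel-verified Lean document; each statement's English description precedes it below -/
import Mathlib

section
/- For each nonnegative integer n, the group Stab(7^{(n)}) is presented by the generators x, b₁, b₂, …, b_{n+1} (where b_{i+1} = x⁻¹·a_i in Q_{4,2}) and the relations: x⁴ = 1 and b_i⁴ = 1 for 1 ≤ i ≤ n+1; [x, b_i] = b_i² for 1 ≤ i ≤ n+1; and [b_i, b_j] = b_i²·b_{j−i}²·b_j² for 1 ≤ i < j ≤ n+1. Precisely, the homomorphism from the free group on the n+2 generators x, b₁, …, b_{n+1} onto Stab(7^{(n)}) sending each generator to the corresponding element is surjective with kernel the normal closure of the corresponding set of relators. -/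
/-!
Common setup: the commutator convention `[a,b] = a⁻¹b⁻¹ab` of the paper, the sequence
`x₀ = x`, `x_{i+1} = [yxy, x_i]`, the Laurent polynomial ring `R = 𝔽₂[t,t⁻¹]`, and the
images `X`, `Y` of `σ₁σ₂σ₃` and `σ₁σ₂σ₃σ₁` in `GL(3, R)` under the mod-2 reduced Burau
representation of the 4-strand braid group.
-/

open Matrix LaurentPolynomial

noncomputable section

set_option maxRecDepth 100000

/-- The paper's commutator convention: `[a,b] = a⁻¹b⁻¹ab`. -/
def br {G : Type*} [Group G] (a b : G) : G := a⁻¹ * b⁻¹ * a * b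

/-- The recursively defined elements `x₀ = x`, `x_{i+1} = [yxy, x_i]`. -/
def xseq {G : Type*} [Group G] (x y : G) : ℕ → G
  | 0 => x
  | n + 1 => br (y * x * y) (xseq x y n)

/-- `R = 𝔽₂[t,t⁻¹]`, the ring of Laurent polynomials over the field with two elements. -/
abbrev R2 : Type := LaurentPolynomial (ZMod 2)

instance : CharP R2 2 := charP_of_injective_algebraMap (algebraMap (ZMod 2) R2).injective 2

/-- The matrix `X = t·!![0,0,1; 1,0,1; 0,1,1]`. -/
def Xmat : Matrix (Fin 3) (Fin 3) R2 := (T 1 : R2) • !![0,0,1; 1,0,1; 0,1,1]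

/-- The matrix `Y = t·!![0,0,1; t,1,1; 0,1,1]`. -/
def Ymat : Matrix (Fin 3) (Fin 3) R2 := (T 1 : R2) • !![0,0,1; T 1,1,1; 0,1,1]

/-- An explicit inverse for `Xmat`. -/
def Xmatinv : Matrix (Fin 3) (Fin 3) R2 := (T (-1) : R2) • !![1,1,0; 1,0,1; 1,0,0]

/-- An explicit inverse for `Ymat`. -/
def Ymatinv : Matrix (Fin 3) (Fin 3) R2 := (T (-2) : R2) • !![0,1,1; T 1,0,T 1; T 1,0,0]

lemma Xmat_mul_Xmatinv : Xmat * Xmatinv = 1 := by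
  rw [Xmat, Xmatinv, Matrix.smul_mul, Matrix.mul_smul, smul_smul, ← T_add]
  simp only [Matrix.mul_fin_three, mul_zero, zero_mul, mul_one, one_mul, add_zero, zero_add,
    ← T_add, CharTwo.add_self_eq_zero]
  rw [Matrix.one_fin_three]
  simp only [Matrix.smul_of, Matrix.smul_cons, smul_eq_mul, Matrix.smul_empty, ← T_add,
    mul_zero, mul_one]
  norm_num [T_zero]

lemma Xmatinv_mul_Xmat : Xmatinv * Xmat = 1 := by
  rw [Xmat, Xmatinv, Matrix.smul_mul, Matrix.mul_smul, smul_smul, ← T_add]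
  simp only [Matrix.mul_fin_three, mul_zero, zero_mul, mul_one, one_mul, add_zero, zero_add,
    ← T_add, CharTwo.add_self_eq_zero]
  rw [Matrix.one_fin_three]
  simp only [Matrix.smul_of, Matrix.smul_cons, smul_eq_mul, Matrix.smul_empty, ← T_add,
    mul_zero, mul_one]
  norm_num [T_zero]

lemma Ymat_mul_Ymatinv : Ymat * Ymatinv = 1 := by
  rw [Ymat, Ymatinv, Matrix.smul_mul, Matrix.mul_smul, smul_smul, ← T_add]
  simp only [Matrix.mul_fin_three, mul_zero, zero_mul, mul_one, one_mul, add_zero, zero_add,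
    ← T_add, CharTwo.add_self_eq_zero]
  rw [Matrix.one_fin_three]
  simp only [Matrix.smul_of, Matrix.smul_cons, smul_eq_mul, Matrix.smul_empty, ← T_add,
    mul_zero, mul_one]
  norm_num [T_zero]

lemma Ymatinv_mul_Ymat : Ymatinv * Ymat = 1 := by
  rw [Ymat, Ymatinv, Matrix.mul_smul, Matrix.smul_mul, smul_smul, ← T_add]
  simp only [Matrix.mul_fin_three, mul_zero, zero_mul, mul_one, one_mul, add_zero, zero_add,
    ← T_add, CharTwo.add_self_eq_zero]
  rw [Matrix.one_fin_three]
  simp only [Matrix.smul_of, Matrix.smul_cons, smul_eq_mul, Matrix.smul_empty, ← T_add,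
    mul_zero, mul_one]
  norm_num [T_zero]

/-- `X ∈ GL(3, 𝔽₂[t,t⁻¹])`, the mod-2 reduced Burau image of `σ₁σ₂σ₃`. -/
def X : GL (Fin 3) R2 := ⟨Xmat, Xmatinv, Xmat_mul_Xmatinv, Xmatinv_mul_Xmat⟩

/-- `Y ∈ GL(3, 𝔽₂[t,t⁻¹])`, the mod-2 reduced Burau image of `σ₁σ₂σ₃σ₁`. -/
def Y : GL (Fin 3) R2 := ⟨Ymat, Ymatinv, Ymat_mul_Ymatinv, Ymatinv_mul_Ymat⟩

/-- `PGL(3, R)`, the projective general linear group: `GL(3,R)` modulo its center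
(the subgroup of scalars). -/
abbrev PGL3 : Type := GL (Fin 3) R2 ⧸ Subgroup.center (GL (Fin 3) R2)

/-- The natural projection `p : GL(3,R) → PGL(3,R)`. -/
def pp : GL (Fin 3) R2 →* PGL3 := QuotientGroup.mk' (Subgroup.center (GL (Fin 3) R2))

/-- `Q_{4,2}`, the subgroup of `PGL(3,R)` generated by `x = p(X)` and `y = p(Y)`. -/
abbrev Q42 : Subgroup PGL3 := Subgroup.closure {pp X, pp Y}

/-- The element `yxy` of `Q_{4,2} ≤ PGL(3,R)`. -/
def wYXY : PGL3 := pp Y * pp X * pp Y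

/-- The elements `a_i = (yxy)^{i+1}·x·(yxy)^{-(i+1)}`. -/
def aEl (i : ℕ) : PGL3 := wYXY ^ (i + 1) * pp X * (wYXY ^ (i + 1))⁻¹

/-- The subgroup `Stab(7^{(n)}) = ⟨x, a₀, a₁, …, a_n⟩` of `Q_{4,2} ≤ PGL(3,R)`. -/
def Stab (n : ℕ) : Subgroup PGL3 :=
  Subgroup.closure ({pp X} ∪ {g | ∃ i ≤ n, g = aEl i})

/-- The homomorphism from the free group on the `n+2` generators `x, b₁, …, b_{n+1}`
sending `x ↦ x` and `b_{i+1} ↦ x⁻¹·a_i`. -/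
def φStabB (n : ℕ) : FreeGroup (Fin (n + 2)) →* PGL3 :=
  FreeGroup.lift (Fin.cases (pp X) fun i : Fin (n + 1) => (pp X)⁻¹ * aEl i)

/-- The relators of Lemma A.2: `x⁴ = 1`, `b_i⁴ = 1`, `[x,b_i] = b_i²` for
`1 ≤ i ≤ n+1`, and `[b_i,b_j] = b_i²·b_{j-i}²·b_j²` for `1 ≤ i < j ≤ n+1`. Here
generator `0` is `x` and generator `i` is `b_i` for `1 ≤ i ≤ n+1`. -/
def stabRelsB (n : ℕ) : Set (FreeGroup (Fin (n + 2))) :=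
  {(FreeGroup.of (0 : Fin (n + 2))) ^ 4} ∪
    {r | ∃ i : ℕ, ∃ _ : 1 ≤ i ∧ i ≤ n + 1, r =
      (FreeGroup.of (⟨i, by omega⟩ : Fin (n + 2))) ^ 4} ∪
    {r | ∃ i : ℕ, ∃ _ : 1 ≤ i ∧ i ≤ n + 1, r =
      br (FreeGroup.of (0 : Fin (n + 2))) (FreeGroup.of (⟨i, by omega⟩ : Fin (n + 2))) *
        ((FreeGroup.of (⟨i, by omega⟩ : Fin (n + 2))) ^ 2)⁻¹} ∪
    {r | ∃ i j : ℕ, ∃ _ : 1 ≤ i ∧ i < j ∧ j ≤ n + 1, r =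
      br (FreeGroup.of (⟨i, by omega⟩ : Fin (n + 2)))
          (FreeGroup.of (⟨j, by omega⟩ : Fin (n + 2))) *
        ((FreeGroup.of (⟨i, by omega⟩ : Fin (n + 2))) ^ 2 *
          (FreeGroup.of (⟨j - i, by omega⟩ : Fin (n + 2))) ^ 2 *
          (FreeGroup.of (⟨j, by omega⟩ : Fin (n + 2))) ^ 2)⁻¹}


lemma m3 {S : Type*} {a b c d e f g h i a' b' c' d' e' f' g' h' i' : S} (h1 : a = a') (h2 : b = b')
    (h3 : c = c') (h4 : d = d') (h5 : e = e') (h6 : f = f') (h7 : g = g') (h8 : h = h')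
    (h9 : i = i') : !![a, b, c; d, e, f; g, h, i] = !![a', b', c'; d', e', f'; g', h', i'] := by
  subst h1 h2 h3 h4 h5 h6 h7 h8 h9; rfl

@[ext] structure Heis where
  p : R2
  q : R2
  r : R2

namespace Heis

instance : Mul Heis := ⟨fun a b => ⟨a.p + b.p, a.q + b.q + a.p * b.r, a.r + b.r⟩⟩
instance : One Heis := ⟨⟨0, 0, 0⟩⟩
instance : Inv Heis := ⟨fun a => ⟨-a.p, -a.q + a.p * a.r, -a.r⟩⟩

lemma mul_p (a b : Heis) : (a * b).p = a.p + b.p := rfl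
lemma mul_q (a b : Heis) : (a * b).q = a.q + b.q + a.p * b.r := rfl
lemma mul_r (a b : Heis) : (a * b).r = a.r + b.r := rfl
lemma one_p : (1 : Heis).p = 0 := rfl
lemma one_q : (1 : Heis).q = 0 := rfl
lemma one_r : (1 : Heis).r = 0 := rfl
lemma inv_p (a : Heis) : (a⁻¹).p = -a.p := rfl
lemma inv_q (a : Heis) : (a⁻¹).q = -a.q + a.p * a.r := rfl
lemma inv_r (a : Heis) : (a⁻¹).r = -a.r := rfl

instance : Group Heis := Group.ofLeftAxioms
  (by intro a b c; apply Heis.ext <;> simp only [mul_p, mul_q, mul_r] <;> ring)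
  (by intro a; apply Heis.ext <;> simp only [mul_p, mul_q, mul_r, one_p, one_q, one_r] <;> ring)
  (by intro a; apply Heis.ext <;> simp only [mul_p, mul_q, mul_r, one_p, one_q, one_r, inv_p, inv_q, inv_r] <;> ring)

def toMat : Heis →* Matrix (Fin 3) (Fin 3) R2 where
  toFun a := !![1, a.p, a.q; 0, 1, a.r; 0, 0, 1]
  map_one' := by rw [Matrix.one_fin_three]; rfl
  map_mul' a b := by
    rw [Matrix.mul_fin_three]
    simp only [mul_p, mul_q, mul_r]
    apply m3 <;> ring

def toGL : Heis →* GL (Fin 3) R2 := toMat.toHomUnits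

lemma toGL_val (a : Heis) : (toGL a : Matrix (Fin 3) (Fin 3) R2) =
  !![1, a.p, a.q; 0, 1, a.r; 0, 0, 1] := rfl

def xh : Heis := ⟨1, 1, 1 + T 1⟩
def ah (k : ℕ) : Heis := ⟨T k, 1, (1 + T 1) * T (-k)⟩
def bh (k : ℕ) : Heis := ⟨1 + T k, (1 + T 1) * (1 + T (-k)), (1 + T 1) * (1 + T (-k))⟩

lemma two0 : (2 : R2) = 0 := CharP.cast_eq_zero R2 2

lemma neg0 (a : R2) : -a = a := CharTwo.neg_eq a

lemma TT (k : ℕ) : (T k : R2) * T (-k) = 1 := by rw [← T_add]; simp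

lemma bh_eq (k : ℕ) : bh k = xh⁻¹ * ah k := by
  apply Heis.ext <;> simp only [bh, xh, ah, mul_p, mul_q, mul_r, inv_p, inv_q, inv_r, neg0]
  · linear_combination (-1 : R2) * two0
  · ring

lemma xh_p : xh.p = 1 := rfl

lemma xh4 : xh ^ 4 = 1 := by
  apply Heis.ext <;> simp only [pow_succ, pow_zero, one_mul, xh, mul_p, mul_q, mul_r, one_p, one_q, one_r]
  · linear_combination 2 * two0
  · linear_combination (5 + 3 * T 1) * two0
  · linear_combination (2 + 2 * T 1) * two0

lemma four (a : Heis) : a ^ 4 = 1 := by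
  apply Heis.ext <;> simp only [pow_succ, pow_zero, one_mul, mul_p, mul_q, mul_r, one_p, one_q, one_r]
  · linear_combination (2 * a.p) * two0
  · linear_combination (2 * a.q + 3 * a.p * a.r) * two0
  · linear_combination (2 * a.r) * two0

lemma sq_eq (a : Heis) : a ^ 2 = ⟨0, a.p * a.r, 0⟩ := by
  apply Heis.ext <;> simp only [pow_succ, pow_zero, one_mul, mul_p, mul_q, mul_r, one_p, one_q, one_r]
  · linear_combination (a.p) * two0
  · linear_combination (a.q) * two0
  · linear_combination (a.r) * two0

lemma br_eq (a b : Heis) : br a b = ⟨0, a.p * b.r + b.p * a.r, 0⟩ := by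
  apply Heis.ext <;> simp only [br, mul_p, mul_q, mul_r, inv_p, inv_q, inv_r]
  · ring
  · linear_combination (-b.p * a.r) * two0
  · ring

lemma sq_bh (k : ℕ) : bh k ^ 2 = ⟨0, (1 + T 1) * (T k + T (-k)), 0⟩ := by
  rw [sq_eq]
  apply Heis.ext <;> simp only [bh]
  linear_combination (1 + T 1) * TT k + (1 + T 1) * two0

lemma sq_xh : xh ^ 2 = ⟨0, (1 + T 1), 0⟩ := by
  rw [sq_eq]
  apply Heis.ext <;> simp only [xh]
  ring

lemma br_xb (k : ℕ) : br xh (bh k) = bh k ^ 2 := by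
  rw [br_eq, sq_bh]
  apply Heis.ext <;> simp only [bh, xh]
  linear_combination (1 + T 1) * two0

lemma br_bb (i j : ℕ) (h : i < j) : br (bh i) (bh j) = bh i ^ 2 * bh (j - i) ^ 2 * bh j ^ 2 := by
  rw [br_eq, sq_bh, sq_bh, sq_bh]
  have h1 : (T i : R2) * T (-j) = T (-((j - i : ℕ) : ℤ)) := by
    rw [← T_add]; congr 1; push_cast [h.le]; ring
  have h2 : (T j : R2) * T (-i) = T ((j - i : ℕ) : ℤ) := by
    rw [← T_add]; congr 1; push_cast [h.le]; ring
  apply Heis.ext <;> simp only [bh, mul_p, mul_q, mul_r]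
  · ring
  · rw [← h1, ← h2]
    linear_combination (1 + T 1) * two0
  · ring

end Heis

/-- change of basis -/
def Cm : Matrix (Fin 3) (Fin 3) R2 := !![1,0,0; 0,1,T 1; 1,1,1]

lemma Cm_det : Cm.det ≠ 0 := by
  have h : Cm.det = 1 + T 1 := by
    rw [Cm, Matrix.det_fin_three]; simp; linear_combination (-T 1) * Heis.two0
  rw [h]
  intro h
  have := congrArg (fun f : R2 => f.coeff 0) h
  simp [← LaurentPolynomial.T_zero] at this

lemma Cm_cancel {A B : Matrix (Fin 3) (Fin 3) R2} (h : Cm * A = Cm * B) : A = B := by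
  have h1 := congrArg (fun M => Cm.adjugate * M) h
  simp only [← Matrix.mul_assoc, Matrix.adjugate_mul, Matrix.smul_mul, Matrix.one_mul] at h1
  exact smul_right_injective _ Cm_det h1

lemma Cm_cancel' {A B : Matrix (Fin 3) (Fin 3) R2} (h : A * Cm = B * Cm) : A = B := by
  have h1 := congrArg (fun M => M * Cm.adjugate) h
  simp only [Matrix.mul_assoc, Matrix.mul_adjugate, Matrix.mul_smul, Matrix.mul_one] at h1
  exact smul_right_injective _ Cm_det h1

def X0m : Matrix (Fin 3) (Fin 3) R2 := !![0,0,1; 1,0,1; 0,1,1]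

def tS : GL (Fin 3) R2 := Matrix.GeneralLinearGroup.scalar (Fin 3) ⟨T 1, T (-1), by
  rw [← T_add]; simp, by rw [← T_add]; simp⟩

lemma tS_mem : tS ∈ Subgroup.center (GL (Fin 3) R2) := by
  rw [Matrix.GeneralLinearGroup.center_eq_range_scalar]; exact ⟨_, rfl⟩

def X0 : GL (Fin 3) R2 := tS⁻¹ * X

lemma X0_val : (X0 : Matrix (Fin 3) (Fin 3) R2) = X0m := by
  have : (X : Matrix (Fin 3) (Fin 3) R2) = (tS : Matrix (Fin 3) (Fin 3) R2) * X0m := by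
    change Xmat = Matrix.scalar _ (T 1) * X0m
    rw [Xmat, Matrix.scalar_apply, ← Matrix.smul_eq_diagonal_mul]; rfl
  rw [X0, Units.val_mul, this, ← Matrix.mul_assoc, ← Units.val_mul]; simp

lemma pp_X0 : pp X0 = pp X := by
  have : pp tS = 1 := (QuotientGroup.eq_one_iff _).2 tS_mem
  rw [X0, map_mul, map_inv, this]; simp

/-- intertwining -/
def Itw (g u : GL (Fin 3) R2) : Prop :=
  (g : Matrix (Fin 3) (Fin 3) R2) * Cm = Cm * (u : Matrix (Fin 3) (Fin 3) R2)

lemma Itw.one : Itw 1 1 := by simp [Itw]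

lemma Itw.mul {g u g' u' : GL (Fin 3) R2} (h : Itw g u) (h' : Itw g' u') :
    Itw (g * g') (u * u') := by
  unfold Itw at *
  rw [Units.val_mul, Matrix.mul_assoc, h', ← Matrix.mul_assoc, h, Matrix.mul_assoc, Units.val_mul]

lemma gen_inv {M : Type*} [Monoid M] (g u : Mˣ) (C : M) (h : (g : M) * C = C * u) :
    ((g⁻¹ : Mˣ) : M) * C = C * ((u⁻¹ : Mˣ) : M) := by
  rw [Units.inv_mul_eq_iff_eq_mul, ← mul_assoc, h, mul_assoc, Units.mul_inv, mul_one]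

lemma Itw.inv {g u : GL (Fin 3) R2} (h : Itw g u) : Itw g⁻¹ u⁻¹ := gen_inv g u Cm h

lemma Itw.pow {g u : GL (Fin 3) R2} (h : Itw g u) (k : ℕ) : Itw (g ^ k) (u ^ k) := by
  induction k with
  | zero => simpa using Itw.one
  | succ k ih => rw [pow_succ, pow_succ]; exact ih.mul h

def dm (k : ℤ) : Matrix (Fin 3) (Fin 3) R2 := !![T (4 * k), 0, 0; 0, T (3 * k), 0; 0, 0, T (4 * k)]

lemma dm_mul (a b : ℤ) : dm a * dm b = dm (a + b) := by
  rw [dm, dm, dm, Matrix.mul_fin_three]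
  simp only [mul_add, T_add]
  apply m3 <;> ring

lemma dm_zero : dm 0 = 1 := by
  rw [dm, Matrix.one_fin_three]
  simp only [mul_zero, T_zero]

def Dg : GL (Fin 3) R2 := ⟨dm 1, dm (-1), by rw [dm_mul]; simp [dm_zero], by rw [dm_mul]; simp [dm_zero]⟩

lemma Dg_pow (k : ℕ) : ((Dg ^ k : GL (Fin 3) R2) : Matrix (Fin 3) (Fin 3) R2) = dm k := by
  induction k with
  | zero => simp [dm_zero]
  | succ k ih => rw [pow_succ, Units.val_mul, ih]; change _ * dm 1 = _; rw [dm_mul]; simp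

lemma T_four (k : ℤ) : (T (4 * k) : R2) = T (3 * k) * T k := by
  rw [← T_add]; congr 1; ring

lemma Tn (k : ℤ) : (T k : R2) * T (-k) = 1 := by rw [← T_add]; simp

lemma D_conj (k : ℕ) : Dg ^ k * Heis.toGL Heis.xh * (Dg ^ k)⁻¹ = Heis.toGL (Heis.ah k) := by
  rw [mul_inv_eq_iff_eq_mul]
  apply Units.ext
  rw [Units.val_mul, Units.val_mul, Dg_pow, Heis.toGL_val, Heis.toGL_val, dm,
    Matrix.mul_fin_three, Matrix.mul_fin_three]
  have := Tn k
  simp only [Heis.xh, Heis.ah, T_four]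
  generalize (T (3 * (k : ℤ)) : R2) = w
  apply m3
  any_goals ring
  linear_combination (-(1 + T 1) * w) * this

lemma inter_X0 : Itw X0 (Heis.toGL Heis.xh) := by
  rw [Itw, X0_val, Heis.toGL_val, X0m, Cm, Matrix.mul_fin_three, Matrix.mul_fin_three]
  simp only [Heis.xh]
  have := Heis.two0
  apply m3
  any_goals ring
  · linear_combination this
  · linear_combination (-T 1) * this
  · linear_combination (-1 : R2) * this

lemma inter_W : Itw (Y * X * Y) Dg := by
  rw [Itw, Units.val_mul, Units.val_mul]
  change Ymat * Xmat * Ymat * _ = _ * dm 1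
  have := Heis.two0
  have h3 : (T 3 : R2) = T 1 ^ 3 := by rw [T_pow]; norm_num
  have h4 : (T 4 : R2) = T 1 ^ 4 := by rw [T_pow]; norm_num
  rw [dm, mul_one, mul_one, h3, h4, Ymat, Xmat, Cm]
  simp only [Matrix.smul_mul, Matrix.mul_smul, Matrix.mul_fin_three, Matrix.smul_of, Matrix.smul_cons, smul_eq_mul, Matrix.smul_empty]
  apply m3
  any_goals ring
  · linear_combination (T 1 ^ 3) * this
  · linear_combination (2 * T 1 ^ 3) * this
  · linear_combination (T 1 ^ 3 + T 1 ^ 4) * this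
  · linear_combination (2 * T 1 ^ 3 + T 1 ^ 4) * this
  · linear_combination (3 * T 1 ^ 3 + T 1 ^ 4) * this
  · linear_combination (2 * T 1 ^ 3 + 2 * T 1 ^ 4) * this
  · linear_combination (2 * T 1 ^ 3) * this
  · linear_combination (3 * T 1 ^ 3) * this
  · linear_combination (2 * T 1 ^ 3 + T 1 ^ 4) * this

/-! abstract part -/

lemma inj_lemma {H V ι : Type*} [Fintype ι] [Group H] [AddCommGroup V] [Module (ZMod 2) V]
    (hc : ∀ a b : H, a * b = b * a) (hs : ∀ a : H, a ^ 2 = 1) (g : ι → H)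
    (hg : Subgroup.closure (Set.range g) = ⊤) (f : H →* Multiplicative V)
    (hf : LinearIndependent (ZMod 2) (fun i => (f (g i)).toAdd)) (a : H) (ha : f a = 1) : a = 1 := by
  letI : CommGroup H := { (inferInstance : Group H) with mul_comm := hc }
  have key : ∀ a : H, ∃ c : ι → ℕ, a = ∏ i, g i ^ c i := by
    intro a
    have : a ∈ Subgroup.closure (Set.range g) := by rw [hg]; trivial
    classical
    induction this using Subgroup.closure_induction with
    | mem x hx =>
      obtain ⟨i, rfl⟩ := hx
      refine ⟨Pi.single i 1, ?_⟩
      rw [Finset.prod_eq_single i] <;> simp +contextual [Pi.single_apply]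
    | one => exact ⟨0, by simp⟩
    | mul x y _ _ hx hy =>
      obtain ⟨c, rfl⟩ := hx
      obtain ⟨d, rfl⟩ := hy
      exact ⟨c + d, by simp [pow_add, Finset.prod_mul_distrib]⟩
    | inv x _ hx =>
      obtain ⟨c, rfl⟩ := hx
      refine ⟨c, inv_eq_of_mul_eq_one_left ?_⟩
      rw [← pow_two]; exact hs _
  obtain ⟨c, rfl⟩ := key a
  rw [Fintype.linearIndependent_iff] at hf
  have h0 := hf (fun i => (c i : ZMod 2)) (by
    have := congrArg Multiplicative.toAdd ha
    simp only [map_prod, map_pow, toAdd_prod, toAdd_pow, toAdd_one] at this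
    rw [← this]
    refine Finset.sum_congr rfl fun i _ => ?_
    rw [Nat.cast_smul_eq_nsmul])
  apply Finset.prod_eq_one
  intro i _
  obtain ⟨k, hk⟩ := (ZMod.natCast_eq_zero_iff (c i) 2).1 (h0 i)
  rw [hk, pow_mul, hs, one_pow]

lemma lin_indep (n : ℕ) (m : ℕ → ℤ) (hm : ∀ i, m i ≤ 0) (v : Fin (n + 2) → R2)
    (h0 : v 0 = 1) (hv : ∀ i : Fin (n + 2), i ≠ 0 → v i = T i + T (m i)) :
    LinearIndependent (ZMod 2) v := by
  rw [Fintype.linearIndependent_iff]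
  intro c hc
  have h1 : ∀ i : Fin (n + 2), i ≠ 0 → c i = 0 := by
    intro i hi
    have h := congrArg (fun f : R2 => f.coeff (i : ℤ)) hc
    have hi' : (0 : ℤ) < (i : ℕ) := by
      have : (i : ℕ) ≠ 0 := fun h => hi (Fin.ext h)
      omega
    simp only [AddMonoidAlgebra.coeff_sum, Finsupp.finset_sum_apply] at h
    rw [Finset.sum_eq_single i] at h
    · rw [hv i hi] at h
      have := hm i
      simpa [show m i ≠ (i : ℕ) by omega] using h
    · intro j _ hj
      by_cases hj0 : j = 0
      · subst hj0
        rw [h0, ← T_zero, AddMonoidAlgebra.coeff_smul, Finsupp.smul_apply, T_apply, if_neg hi'.ne, smul_zero]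
      · rw [hv j hj0]
        have := hm j
        have h3 : ((j : ℕ) : ℤ) ≠ (i : ℕ) := by
          intro h; exact hj (Fin.ext (by exact_mod_cast h))
        simp [show m j ≠ (i : ℕ) by omega]
        intro h; exact absurd (Fin.ext h) hj
    · simp
  have h2 : c 0 = 0 := by
    rw [Finset.sum_eq_single 0 (fun j _ hj => by rw [h1 j hj, zero_smul]) (by simp), h0] at hc
    have h := congrArg (fun f : R2 => f.coeff 0) hc
    rw [← T_zero] at h
    simpa using h
  intro i
  by_cases hi : i = 0
  · rw [hi, h2]
  · exact h1 i hi

section abs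
variable {G : Type*} [Group G]

lemma conj_inv_x {x b : G} (h : br x b = b ^ 2) : x⁻¹ * b * x = b⁻¹ := by
  have h1 : x⁻¹ * b⁻¹ * x * b = b * b := by rw [← pow_two]; exact h
  have h2 : x⁻¹ * b⁻¹ * x = b := mul_right_cancel h1
  have h3 : x⁻¹ * b * x = (x⁻¹ * b⁻¹ * x)⁻¹ := by group
  rw [h3, h2]

lemma inv_of_four {b : G} (h : b ^ 4 = 1) : b⁻¹ ^ 2 = b ^ 2 := by
  rw [inv_pow, inv_eq_iff_mul_eq_one, ← pow_add]; exact h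

lemma x_sq {x b : G} (hb : b ^ 4 = 1) (h : br x b = b ^ 2) : Commute x (b ^ 2) := by
  have h1 := conj_inv_x h
  have h2 : x⁻¹ * b ^ 2 * x = b ^ 2 := by
    have : x⁻¹ * b ^ 2 * x = (x⁻¹ * b * x) ^ 2 := by rw [pow_two, pow_two]; group
    rw [this, h1, inv_of_four hb]
  have h3 : b ^ 2 * x = x * b ^ 2 := by
    nth_rw 2 [← h2]; group
  exact h3.symm

lemma sq_x {x b : G} (h : br x b = b ^ 2) : Commute (x ^ 2) b := by
  have h1 := conj_inv_x h
  have h2 : (x ^ 2)⁻¹ * b * x ^ 2 = b := by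
    have : (x ^ 2)⁻¹ * b * x ^ 2 = x⁻¹ * (x⁻¹ * b * x) * x := by rw [pow_two]; group
    rw [this, h1]
    have : x⁻¹ * b⁻¹ * x = (x⁻¹ * b * x)⁻¹ := by group
    rw [this, h1, inv_inv]
  have h3 : b * x ^ 2 = x ^ 2 * b := by
    nth_rw 2 [← h2]; group
  exact h3.symm

/-- relation `[a,b] = a² z b²` rewritten -/
lemma rel1 {a b z : G} (ha : a ^ 4 = 1) (h : br a b = a ^ 2 * z * b ^ 2) :
    a * b⁻¹ * a = z * b := by
  have h1 : a⁻¹ * b⁻¹ * a * b = a ^ 2 * z * b * b := by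
    rw [mul_assoc (a ^ 2 * z), ← pow_two]; exact h
  have h2 := mul_right_cancel h1
  have h3 : a * b⁻¹ * a = a ^ 2 * (a⁻¹ * b⁻¹ * a) := by rw [pow_two]; group
  rw [h3, h2]
  have : a ^ 2 * (a ^ 2 * z * b) = a ^ 4 * (z * b) := by
    simp only [← mul_assoc, ← pow_add]
  rw [this, ha, one_mul]

lemma comm_zb {x a b c : G} (ha : a ^ 4 = 1) (hb : b ^ 4 = 1) (hc : c ^ 4 = 1)
    (hxa : br x a = a ^ 2) (hxb : br x b = b ^ 2) (hxc : br x c = c ^ 2)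
    (h : br a b = a ^ 2 * c ^ 2 * b ^ 2) : Commute (c ^ 2) b := by
  have e1 := rel1 ha h
  have e2 : a⁻¹ * b * a⁻¹ = c ^ 2 * b⁻¹ := by
    have h2 := congrArg (fun g => x⁻¹ * g * x) e1
    have hz : x⁻¹ * c ^ 2 * x = c ^ 2 := by
      rw [mul_assoc, ← (x_sq hc hxc).eq, ← mul_assoc, inv_mul_cancel, one_mul]
    have l : x⁻¹ * (a * b⁻¹ * a) * x = (x⁻¹ * a * x) * (x⁻¹ * b * x)⁻¹ * (x⁻¹ * a * x) := by group
    have r : x⁻¹ * (c ^ 2 * b) * x = (x⁻¹ * c ^ 2 * x) * (x⁻¹ * b * x) := by group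
    simp only [l, r, hz, conj_inv_x hxa, conj_inv_x hxb, inv_inv] at h2
    exact h2
  have e3 : a⁻¹ * b * a⁻¹ = b⁻¹ * c ^ 2 := by
    have h3 := congrArg (fun g => g⁻¹) e1
    simp only [_root_.mul_inv_rev, inv_inv, ← inv_pow, inv_of_four hc] at h3
    rw [mul_assoc]; exact h3
  have : Commute (c ^ 2) b⁻¹ := e2.symm.trans e3
  simpa using this.inv_right

lemma comm_bsq {a b z : G} (ha : a ^ 4 = 1) (hb : b ^ 4 = 1) (hz : z ^ 2 = 1)
    (hzb : Commute z b) (hab : Commute (a ^ 2) b) (hza : Commute z (a ^ 2))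
    (h : br a b = a ^ 2 * z * b ^ 2) : Commute a (b ^ 2) := by
  have e1 := rel1 ha h
  have e2 : a * b⁻¹ * a⁻¹ = z * a ^ 2 * b := by
    have : a * b⁻¹ * a⁻¹ = (a * b⁻¹ * a) * (a⁻¹) ^ 2 := by rw [pow_two]; group
    rw [this, e1, inv_of_four ha, mul_assoc, ← hab.eq, mul_assoc]
  have e3 : a * b ^ 2 * a⁻¹ = b ^ 2 := by
    have : a * (b⁻¹) ^ 2 * a⁻¹ = (a * b⁻¹ * a⁻¹) ^ 2 := by rw [pow_two, pow_two]; group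
    rw [inv_of_four hb, e2, (hzb.mul_left hab).mul_pow, hza.mul_pow, hz, ← pow_mul, ha] at this
    simpa using this
  have := mul_inv_eq_iff_eq_mul.1 e3
  exact this

end abs

lemma core {G : Type*} [Group G] (n : ℕ) (b : ℕ → G)
    (hgen : Subgroup.closure (Set.range fun i : Fin (n + 2) => b i) = ⊤)
    (h4 : ∀ i, i ≤ n + 1 → b i ^ 4 = 1)
    (hx : ∀ i, 1 ≤ i → i ≤ n + 1 → br (b 0) (b i) = b i ^ 2)
    (hb : ∀ i j, 1 ≤ i → i < j → j ≤ n + 1 → br (b i) (b j) = b i ^ 2 * b (j - i) ^ 2 * b j ^ 2)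
    (f : G →* Heis) (f0 : f (b 0) = Heis.xh)
    (fb : ∀ i, 1 ≤ i → i ≤ n + 1 → f (b i) = Heis.bh i) (g : G) (hg : f g = 1) : g = 1 := by
  have c1 : ∀ k j, 1 ≤ k → k < j → j ≤ n + 1 → Commute (b k ^ 2) (b j) := by
    intro k j h1 h2 h3
    have := hb (j - k) j (by omega) (by omega) h3
    rw [show j - (j - k) = k by omega] at this
    exact comm_zb (h4 _ (by omega)) (h4 _ h3) (h4 _ (by omega)) (hx _ (by omega) (by omega))
      (hx _ (by omega) (by omega)) (hx _ (by omega) (by omega)) this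
  have csq : ∀ k j, 1 ≤ k → k ≤ n + 1 → 1 ≤ j → j ≤ n + 1 → Commute (b k ^ 2) (b j ^ 2) := by
    intro k j h1 h2 h3 h5
    rcases lt_trichotomy k j with h | h | h
    · exact (c1 k j h1 h h5).pow_right 2
    · rw [h]
    · exact ((c1 j k h3 h h2).pow_right 2).symm
  have cen : ∀ k j, k ≤ n + 1 → j ≤ n + 1 → Commute (b k ^ 2) (b j) := by
    intro k j hk hj
    rcases Nat.eq_zero_or_pos k with rfl | hk0
    · rcases Nat.eq_zero_or_pos j with rfl | hj0
      · exact (Commute.refl _).pow_left 2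
      · exact sq_x (hx j hj0 hj)
    · rcases Nat.eq_zero_or_pos j with rfl | hj0
      · exact (x_sq (h4 k hk) (hx k hk0 hk)).symm
      · rcases lt_trichotomy k j with h | h | h
        · exact c1 k j hk0 h hj
        · rw [h]; exact (Commute.refl _).pow_left 2
        · refine (comm_bsq (h4 j hj) (h4 k hk) (z := b (k - j) ^ 2) ?_ ?_ ?_ ?_
            (hb j k hj0 h hk)).symm
          · rw [← pow_mul]; exact h4 _ (by omega)
          · exact c1 _ _ (by omega) (by omega) hk
          · exact c1 _ _ hj0 h hk
          · exact csq _ _ (by omega) (by omega) hj0 hj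
  let s : Fin (n + 2) → G := fun i => b i ^ 2
  let Z : Subgroup G := Subgroup.closure (Set.range s)
  have hle : ∀ i : Fin (n + 2), (i : ℕ) ≤ n + 1 := fun i => by omega
  have sZ : ∀ i, i ≤ n + 1 → b i ^ 2 ∈ Z := fun i hi =>
    Subgroup.subset_closure ⟨⟨i, by omega⟩, rfl⟩
  have hZc : Z ≤ Subgroup.center G := by
    rw [Subgroup.closure_le]
    rintro _ ⟨i, rfl⟩
    have : (⊤ : Subgroup G) ≤ Subgroup.centralizer {s i} := by
      rw [← hgen, Subgroup.closure_le]
      rintro _ ⟨j, rfl⟩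
      rw [SetLike.mem_coe, Subgroup.mem_centralizer_singleton_iff]
      exact (cen i j (hle i) (hle j)).symm
    rw [SetLike.mem_coe, Subgroup.mem_center_iff]
    intro a
    exact Subgroup.mem_centralizer_singleton_iff.1 (this (Subgroup.mem_top a))
  haveI hZn : Z.Normal := ⟨fun z hz a => by
    rw [Subgroup.mem_center_iff.1 (hZc hz) a]; simpa using hz⟩
  have hZsq : ∀ z ∈ Z, z ^ 2 = 1 := by
    intro z hz
    induction hz using Subgroup.closure_induction with
    | mem x hx => obtain ⟨i, rfl⟩ := hx; simp only [s]; rw [← pow_mul]; exact h4 _ (hle i)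
    | one => simp
    | mul x y hx hy h1 h2 =>
      have : Commute x y := Subgroup.mem_center_iff.1 (hZc hy) x
      rw [this.mul_pow, h1, h2, one_mul]
    | inv x _ h => rw [inv_pow, h, inv_one]
  -- quotient
  have mkcomm : ∀ i j, i ≤ n + 1 → j ≤ n + 1 → br (b i) (b j) ∈ Z := by
    have main : ∀ i j, i < j → j ≤ n + 1 → br (b i) (b j) ∈ Z := by
      intro i j h1 h2
      rcases Nat.eq_zero_or_pos i with rfl | hi
      · rw [hx j h1 h2]; exact sZ j h2
      · rw [hb i j hi h1 h2]
        exact mul_mem (mul_mem (sZ _ (by omega)) (sZ _ (by omega))) (sZ _ h2)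
    intro i j hi hj
    rcases lt_trichotomy i j with h | h | h
    · exact main i j h hj
    · rw [h]; simp [br]
    · have := inv_mem (main j i h hi)
      have e : (br (b j) (b i))⁻¹ = br (b i) (b j) := by simp only [br]; group
      rwa [e] at this
  let q : Fin (n + 2) → G ⧸ Z := fun i => (b i : G)
  have hqgen : Subgroup.closure (Set.range q) = ⊤ := by
    have := congrArg (Subgroup.map (QuotientGroup.mk' Z)) hgen
    rw [MonoidHom.map_closure, ← Set.range_comp, Subgroup.map_top_of_surjective _
      (QuotientGroup.mk'_surjective Z)] at this
    exact this
  have hqc0 : ∀ i j, Commute (q i) (q j) := by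
    intro i j
    have h1 := (QuotientGroup.eq_one_iff _).2 (mkcomm i j (hle i) (hle j))
    have h2 : (q i)⁻¹ * (q j)⁻¹ * q i * q j = 1 := h1
    have h3 : q j * q i = q i * q j := by
      have : q i * q j = q j * q i * ((q i)⁻¹ * (q j)⁻¹ * q i * q j) := by group
      rw [this, h2, mul_one]
    exact h3.symm
  have hqc : ∀ u v : G ⧸ Z, u * v = v * u := by
    have h1 : ∀ i, q i ∈ Subgroup.center (G ⧸ Z) := by
      intro i
      have : (⊤ : Subgroup (G ⧸ Z)) ≤ Subgroup.centralizer {q i} := by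
        rw [← hqgen, Subgroup.closure_le]
        rintro _ ⟨j, rfl⟩
        rw [SetLike.mem_coe, Subgroup.mem_centralizer_singleton_iff]
        exact (hqc0 j i)
      rw [Subgroup.mem_center_iff]
      intro a
      exact Subgroup.mem_centralizer_singleton_iff.1 (this (Subgroup.mem_top a))
    have h2 : (⊤ : Subgroup (G ⧸ Z)) ≤ Subgroup.center (G ⧸ Z) := by
      rw [← hqgen, Subgroup.closure_le]
      rintro _ ⟨j, rfl⟩
      exact h1 j
    intro u v
    exact Subgroup.mem_center_iff.1 (h2 (Subgroup.mem_top v)) u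
  have hqs : ∀ u : G ⧸ Z, u ^ 2 = 1 := by
    intro u
    have : u ∈ Subgroup.closure (Set.range q) := by rw [hqgen]; trivial
    induction this using Subgroup.closure_induction with
    | mem x hx =>
      obtain ⟨i, rfl⟩ := hx
      exact (QuotientGroup.eq_one_iff (b i ^ 2)).2 (sZ i (hle i))
    | one => simp
    | mul x y hx hy h1 h2 =>
      rw [(show Commute x y from hqc x y).mul_pow, h1, h2, one_mul]
    | inv x _ h => rw [inv_pow, h, inv_one]
  have hf0 : ∀ z ∈ Z, (f z).p = 0 ∧ (f z).r = 0 := by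
    intro z hz
    induction hz using Subgroup.closure_induction with
    | mem x hx =>
      obtain ⟨i, rfl⟩ := hx
      simp only [s]
      rw [map_pow, Heis.sq_eq]; exact ⟨rfl, rfl⟩
    | one => rw [map_one]; exact ⟨rfl, rfl⟩
    | mul x y hx hy h1 h2 =>
      rw [map_mul, Heis.mul_p, Heis.mul_r, h1.1, h1.2, h2.1, h2.2]; simp
    | inv x _ h => rw [map_inv, Heis.inv_p, Heis.inv_r, h.1, h.2]; simp
  let P : G →* Multiplicative R2 :=
    { toFun := fun a => Multiplicative.ofAdd (f a).p
      map_one' := by rw [map_one]; rfl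
      map_mul' := fun a c => by rw [map_mul]; rfl }
  let Pq : G ⧸ Z →* Multiplicative R2 := QuotientGroup.lift Z P (by
    intro z hz
    rw [MonoidHom.mem_ker]
    exact congrArg Multiplicative.ofAdd (hf0 z hz).1)
  have hgZ : g ∈ Z := by
    rw [← QuotientGroup.eq_one_iff]
    refine inj_lemma hqc hqs q hqgen Pq ?_ (g : G ⧸ Z) ?_
    · refine lin_indep n (fun _ => 0) (fun _ => le_rfl) _ ?_ ?_
      · change (f (b 0)).p = 1
        rw [f0]; rfl
      · intro i hi
        have : 1 ≤ (i : ℕ) := Nat.one_le_iff_ne_zero.2 fun h => hi (Fin.ext h)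
        change (f (b i)).p = _
        rw [fb i this (hle i), T_zero]; exact add_comm _ _
    · change Multiplicative.ofAdd (f g).p = 1
      rw [hg]; rfl
  let Qz : Z →* Multiplicative R2 :=
    { toFun := fun a => Multiplicative.ofAdd (f a).q
      map_one' := by rw [Subgroup.coe_one, map_one]; rfl
      map_mul' := fun a c => by
        rw [Subgroup.coe_mul, map_mul, Heis.mul_q, (hf0 a a.2).1, zero_mul, add_zero]; rfl }
  have fin : (⟨g, hgZ⟩ : Z) = 1 := by
    refine inj_lemma ?_ ?_ (fun i : Fin (n + 2) => (⟨s i, sZ i (hle i)⟩ : Z)) ?_ Qz ?_ _ ?_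
    · rintro ⟨u, hu⟩ ⟨v, hv⟩
      exact Subtype.ext (Subgroup.mem_center_iff.1 (hZc hv) u)
    · rintro ⟨u, hu⟩
      exact Subtype.ext (hZsq u hu)
    · have := Subgroup.closure_closure_coe_preimage (k := Set.range s)
      rw [← this]
      congr 1
      ext ⟨z, hz⟩
      simp [Subtype.ext_iff]
    · have hl : LinearIndependent (ZMod 2)
          (fun i : Fin (n + 2) => if i = 0 then (1 : R2) else T i + T (-(i : ℕ))) := by
        refine lin_indep n (fun i => -i) (fun i => by simp) _ (by simp) ?_
        intro i hi
        simp [hi]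
      have hne : (1 + T 1 : R2) ≠ 0 := by
        intro h
        have := congrArg (fun f : R2 => f.coeff 0) h
        simp [← LaurentPolynomial.T_zero] at this
      have h2 := hl.map' (LinearMap.mulLeft (ZMod 2) (1 + T 1 : R2))
        (LinearMap.ker_eq_bot.2 (mul_right_injective₀ hne))
      convert h2 using 1
      ext1 i
      change (f (b i ^ 2)).q = (1 + T 1) * _
      rw [map_pow]
      beta_reduce
      by_cases hi : i = 0
      · subst hi
        rw [if_pos rfl, mul_one]
        change (f (b 0) ^ 2).q = _
        rw [f0, Heis.sq_xh]
      · have : 1 ≤ (i : ℕ) := Nat.one_le_iff_ne_zero.2 fun h => hi (Fin.ext h)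
        rw [if_neg hi, fb i this (hle i), Heis.sq_bh]
      rfl
    · change Multiplicative.ofAdd (f g).q = 1
      rw [hg]; rfl
  exact congrArg Subtype.val fin

/-- lift to `GL` -/
def rho (n : ℕ) : FreeGroup (Fin (n + 2)) →* GL (Fin 3) R2 :=
  FreeGroup.lift (Fin.cases X0 fun i : Fin (n + 1) =>
    X0⁻¹ * ((Y * X * Y) ^ ((i : ℕ) + 1) * X0 * ((Y * X * Y) ^ ((i : ℕ) + 1))⁻¹))

/-- lift to `Heis` -/
def hh (n : ℕ) : FreeGroup (Fin (n + 2)) →* Heis :=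
  FreeGroup.lift (Fin.cases Heis.xh fun i : Fin (n + 1) => Heis.bh ((i : ℕ) + 1))

lemma pp_rho (n : ℕ) (g) : pp (rho n g) = φStabB n g := by
  have : pp.comp (rho n) = φStabB n := by
    apply FreeGroup.ext_hom
    intro i
    simp only [MonoidHom.comp_apply, rho, φStabB, FreeGroup.lift_apply_of]
    refine Fin.cases ?_ (fun i => ?_) i
    · exact pp_X0
    · simp only [Fin.cases_succ, map_mul, map_inv, map_pow, pp_X0, aEl, wYXY]
  rw [← this]; rfl

lemma itw_rho (n : ℕ) (g) : Itw (rho n g) (Heis.toGL (hh n g)) := by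
  induction g using FreeGroup.induction_on with
  | C1 => simpa using Itw.one
  | of i =>
    simp only [rho, hh, FreeGroup.lift_apply_of]
    refine Fin.cases ?_ (fun i => ?_) i
    · exact inter_X0
    · simp only [Fin.cases_succ]
      rw [Heis.bh_eq, map_mul, map_inv, ← D_conj]
      exact inter_X0.inv.mul (((inter_W.pow _).mul inter_X0).mul (inter_W.pow _).inv)
  | inv_of i h => rw [map_inv, map_inv, map_inv]; exact h.inv
  | mul x y hx hy => rw [map_mul, map_mul, map_mul]; exact hx.mul hy

lemma phi_eq_one_iff (n : ℕ) (g) : φStabB n g = 1 ↔ hh n g = 1 := by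
  have hI := itw_rho n g
  rw [← pp_rho]
  constructor
  · intro h
    have h1 : rho n g ∈ Subgroup.center (GL (Fin 3) R2) := (QuotientGroup.eq_one_iff _).1 h
    rw [Matrix.GeneralLinearGroup.center_eq_range_scalar] at h1
    obtain ⟨u, hu⟩ := h1
    rw [← hu, Itw] at hI
    have h2 : Cm * ((u : R2) • (1 : Matrix (Fin 3) (Fin 3) R2)) = Cm * (Heis.toGL (hh n g)) := by
      rw [← hI]
      change _ = Matrix.scalar _ (u : R2) * Cm
      rw [Matrix.scalar_apply, ← Matrix.smul_eq_diagonal_mul, Matrix.mul_smul, Matrix.mul_one]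
    have h3 := Cm_cancel h2
    rw [Heis.toGL_val] at h3
    apply Heis.ext
    all_goals simp only [Heis.one_p, Heis.one_q, Heis.one_r]
    · simpa using (congrFun (congrFun h3 0) 1).symm
    · simpa using (congrFun (congrFun h3 0) 2).symm
    · simpa using (congrFun (congrFun h3 1) 2).symm
  · intro h
    rw [h, map_one, Itw] at hI
    have h1 : ((rho n g : GL (Fin 3) R2) : Matrix (Fin 3) (Fin 3) R2) = 1 := by
      apply Cm_cancel'
      rw [hI, Units.val_one, Matrix.mul_one, Matrix.one_mul]
    have h2 : rho n g = 1 := Units.ext h1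
    rw [h2, map_one]

lemma hh_zero (n : ℕ) : hh n (FreeGroup.of 0) = Heis.xh := by
  simp only [hh, FreeGroup.lift_apply_of]; rfl

lemma hh_pos (n i : ℕ) (h1 : 1 ≤ i) (h2 : i < n + 2) :
    hh n (FreeGroup.of ⟨i, h2⟩) = Heis.bh i := by
  obtain ⟨k, rfl⟩ : ∃ k, i = k + 1 := ⟨i - 1, by omega⟩
  simp only [hh, FreeGroup.lift_apply_of]; rfl

lemma map_br {G H : Type*} [Group G] [Group H] (f : G →* H) (a b : G) :
    f (br a b) = br (f a) (f b) := by simp [br]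

lemma rels_le (n : ℕ) : Subgroup.normalClosure (stabRelsB n) ≤ (hh n).ker := by
  apply Subgroup.normalClosure_le_normal
  rintro r (((h | ⟨i, hi, h⟩) | ⟨i, hi, h⟩) | ⟨i, j, hi, h⟩)
  · rw [Set.mem_singleton_iff.1 h, SetLike.mem_coe, MonoidHom.mem_ker, map_pow, Heis.four]
  · rw [h, SetLike.mem_coe, MonoidHom.mem_ker, map_pow, Heis.four]
  · rw [h, SetLike.mem_coe, MonoidHom.mem_ker, map_mul, map_inv, map_br, map_pow, hh_zero,
      hh_pos n i hi.1, Heis.br_xb, mul_inv_cancel]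
  · rw [h, SetLike.mem_coe, MonoidHom.mem_ker, map_mul, map_inv, map_br, map_mul, map_mul, map_pow,
      map_pow, map_pow, hh_pos n i hi.1, hh_pos n j (by omega), hh_pos n (j - i) (by omega),
      Heis.br_bb i j hi.2.1, mul_inv_cancel]

lemma ker_le (n : ℕ) : (hh n).ker ≤ Subgroup.normalClosure (stabRelsB n) := by
  intro g hg
  let N := Subgroup.normalClosure (stabRelsB n)
  let b : ℕ → FreeGroup (Fin (n + 2)) ⧸ N := fun i =>
    if h : i < n + 2 then QuotientGroup.mk' N (FreeGroup.of ⟨i, h⟩) else 1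
  have hb : ∀ i (h : i < n + 2), b i = QuotientGroup.mk' N (FreeGroup.of ⟨i, h⟩) :=
    fun i h => dif_pos h
  have hb0 : b 0 = QuotientGroup.mk' N (FreeGroup.of 0) := hb 0 (by omega)
  have rel : ∀ r ∈ stabRelsB n, QuotientGroup.mk' N r = 1 := fun r hr =>
    (QuotientGroup.eq_one_iff r).2 (Subgroup.subset_normalClosure hr)
  rw [← QuotientGroup.eq_one_iff]
  refine core n b ?_ ?_ ?_ ?_ (QuotientGroup.lift N (hh n) (rels_le n)) ?_ ?_ _ ?_
  · have h1 := congrArg (Subgroup.map (QuotientGroup.mk' N))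
      (FreeGroup.closure_range_of (Fin (n + 2)))
    rw [MonoidHom.map_closure, ← Set.range_comp, Subgroup.map_top_of_surjective _
      (QuotientGroup.mk'_surjective N)] at h1
    rw [← h1]
    congr 2
    ext1 i
    exact hb i i.2
  · intro i hi
    rw [hb i (by omega), ← map_pow]
    apply rel
    rcases Nat.eq_zero_or_pos i with rfl | h
    · exact Or.inl (Or.inl (Or.inl rfl))
    · exact Or.inl (Or.inl (Or.inr ⟨i, ⟨h, hi⟩, rfl⟩))
  · intro i h1 h2
    have := rel _ (Or.inl (Or.inr ⟨i, ⟨h1, h2⟩, rfl⟩))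
    rw [map_mul, map_inv, map_br, map_pow, mul_inv_eq_one] at this
    rw [hb0, hb i (by omega)]
    exact this
  · intro i j h1 h2 h3
    have := rel _ (Or.inr ⟨i, j, ⟨h1, h2, h3⟩, rfl⟩)
    rw [map_mul, map_inv, map_br, map_mul, map_mul, map_pow, map_pow, map_pow,
      mul_inv_eq_one] at this
    rw [hb i (by omega), hb j (by omega), hb (j - i) (by omega)]
    exact this
  · rw [hb0]; exact hh_zero n
  · intro i h1 h2
    rw [hb i (by omega)]; exact hh_pos n i h1 _
  · exact hg

lemma range_eq (n : ℕ) : (φStabB n).range = Stab n := by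
  have hx : φStabB n (FreeGroup.of 0) = pp X := by
    simp only [φStabB, FreeGroup.lift_apply_of]; rfl
  have hs : ∀ i : Fin (n + 1), φStabB n (FreeGroup.of i.succ) = (pp X)⁻¹ * aEl i := fun i => by
    simp only [φStabB, FreeGroup.lift_apply_of]; rfl
  have hX : pp X ∈ Stab n := Subgroup.subset_closure (Or.inl rfl)
  apply le_antisymm
  · rw [MonoidHom.range_eq_map, ← FreeGroup.closure_range_of, MonoidHom.map_closure,
      Subgroup.closure_le]
    rintro _ ⟨_, ⟨i, rfl⟩, rfl⟩
    refine Fin.cases ?_ (fun i => ?_) i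
    · rw [hx]; exact hX
    · rw [hs]
      exact mul_mem (inv_mem hX) (Subgroup.subset_closure (Or.inr ⟨i, by omega, rfl⟩))
  · rw [Stab, Subgroup.closure_le]
    rintro _ (h | ⟨i, hi, rfl⟩)
    · exact ⟨FreeGroup.of 0, by rw [hx]; exact h.symm⟩
    · refine ⟨FreeGroup.of 0 * FreeGroup.of (Fin.succ ⟨i, by omega⟩), ?_⟩
      rw [map_mul, hx, hs, mul_inv_cancel_left]

theorem statement11 (n : ℕ) :
    (φStabB n).range = Stab n ∧
      (φStabB n).ker = Subgroup.normalClosure (stabRelsB n) := by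
  refine ⟨range_eq n, ?_⟩
  have h : (φStabB n).ker = (hh n).ker := by
    ext g
    exact phi_eq_one_iff n g
  rw [h]
  exact le_antisymm (ker_le n) (rels_le n)
end
end

section
/- For each nonnegative integer n, the commutator (derived) subgroup of P_n equals the subgroup generated by b₁², …, b_{n+1}²; this subgroup is elementary abelian of order 2^{n+1} (isomorphic to (ℤ/2ℤ)^{n+1}), it is contained in the center of P_n (so P_n is nilpotent of class at most 2), and the abelianization of P_n is isomorphic to ℤ/4ℤ × (ℤ/2ℤ)^{n+1}. -/
noncomputable section

/-- The relators of `P_n`: `x⁴ = 1`, `b_i⁴ = 1` and `[x,b_i] = b_i²` for `1 ≤ i ≤ n+1`,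
and `[b_i,b_j] = b_i²·b_{j-i}²·b_j²` for `1 ≤ i < j ≤ n+1`. Here generator `0` is `x`
and generator `i` is `b_i` for `1 ≤ i ≤ n+1`. -/
def pnRels (n : ℕ) : Set (FreeGroup (Fin (n + 2))) :=
  {(FreeGroup.of (0 : Fin (n + 2))) ^ 4} ∪
    {r | ∃ i : ℕ, ∃ _ : 1 ≤ i ∧ i ≤ n + 1, r =
      (FreeGroup.of (⟨i, by omega⟩ : Fin (n + 2))) ^ 4} ∪
    {r | ∃ i : ℕ, ∃ _ : 1 ≤ i ∧ i ≤ n + 1, r =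
      br (FreeGroup.of (0 : Fin (n + 2))) (FreeGroup.of (⟨i, by omega⟩ : Fin (n + 2))) *
        ((FreeGroup.of (⟨i, by omega⟩ : Fin (n + 2))) ^ 2)⁻¹} ∪
    {r | ∃ i j : ℕ, ∃ _ : 1 ≤ i ∧ i < j ∧ j ≤ n + 1, r =
      br (FreeGroup.of (⟨i, by omega⟩ : Fin (n + 2)))
          (FreeGroup.of (⟨j, by omega⟩ : Fin (n + 2))) *
        ((FreeGroup.of (⟨i, by omega⟩ : Fin (n + 2))) ^ 2 *
          (FreeGroup.of (⟨j - i, by omega⟩ : Fin (n + 2))) ^ 2 *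
          (FreeGroup.of (⟨j, by omega⟩ : Fin (n + 2))) ^ 2)⁻¹}

/-- The group `P_n`, presented on generators `x, b₁, …, b_{n+1}` with the relations
`1_b)–3_b)` (isomorphic to `Stab(7^{(n)})`). -/
abbrev Pn (n : ℕ) : Type := PresentedGroup (pnRels n)

/-- The generator `x` of `P_n`. -/
def pnx (n : ℕ) : Pn n := PresentedGroup.of 0

/-- The set `{x², b₁², …, b_{n+1}²}` in `P_n`. -/
def pnSq (n : ℕ) : Set (Pn n) :=
  {pnx n ^ 2} ∪
    {g | ∃ i : ℕ, ∃ _ : 1 ≤ i ∧ i ≤ n + 1, g =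
      (PresentedGroup.of (⟨i, by omega⟩ : Fin (n + 2)) : Pn n) ^ 2}

/-- The set `{b₁², …, b_{n+1}²}` in `P_n`. -/
def pnSqB (n : ℕ) : Set (Pn n) :=
  {g | ∃ i : ℕ, ∃ _ : 1 ≤ i ∧ i ≤ n + 1, g =
    (PresentedGroup.of (⟨i, by omega⟩ : Fin (n + 2)) : Pn n) ^ 2}


/-! ### Group theory lemmas -/

lemma half_lem {G : Type*} [Group G] (a z d : G) (hz : z * z = 1) (hza : z * a = a * z)
    (h : a⁻¹ * d⁻¹ * a * d = z * d ^ 2) : d * a ^ 2 = a ^ 2 * (z * d * z) := by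
  have hzi : z⁻¹ = z := inv_eq_of_mul_eq_one_left hz
  have h1 : a⁻¹ * d⁻¹ * a = z * d := by
    apply mul_right_cancel (b := d)
    rw [h, pow_two, mul_assoc]
  have h2 : a⁻¹ * d * a = d⁻¹ * z := by
    have := congrArg (·⁻¹) h1
    simp only [mul_inv_rev, inv_inv, hzi] at this
    rw [← this]; group
  have e1 : d * a = a * (d⁻¹ * z) := by rw [← h2]; group
  have e2 : d⁻¹ * a = a * (z * d) := by rw [← h1]; group
  calc d * a ^ 2 = (d * a) * a := by rw [pow_two, mul_assoc]
    _ = a * d⁻¹ * (z * a) := by rw [e1]; group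
    _ = a * (d⁻¹ * a) * z := by rw [hza]; group
    _ = _ := by rw [e2]; simp only [pow_two, mul_assoc]

lemma key_lem {G : Type*} [Group G] (a c d : G) (ha : a ^ 4 = 1) (hc : c ^ 4 = 1)
    (hd : d ^ 4 = 1) (hac : Commute (a ^ 2) c) (hca : Commute (c ^ 2) a)
    (h1 : a⁻¹ * d⁻¹ * a * d = a ^ 2 * c ^ 2 * d ^ 2)
    (h2 : c⁻¹ * d⁻¹ * c * d = c ^ 2 * a ^ 2 * d ^ 2) :
    Commute (a ^ 2) d ∧ Commute (d ^ 2) a := by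
  have hac2 : Commute (a ^ 2) (c ^ 2) := hac.pow_right 2
  have haa : Commute (a ^ 2) a := (Commute.refl a).pow_left 2
  have hcc : Commute (c ^ 2) c := (Commute.refl c).pow_left 2
  obtain ⟨z, hzdef⟩ : ∃ z, z = a ^ 2 * c ^ 2 := ⟨_, rfl⟩
  have hza : Commute z a := by rw [hzdef]; exact haa.mul_left hca
  have hzc : Commute z c := by rw [hzdef]; exact hac.mul_left hcc
  have hz : z * z = 1 := by
    have : (a ^ 2 * c ^ 2) ^ 2 = 1 := by
      rw [hac2.mul_pow, ← pow_mul, ← pow_mul, ha, hc, one_mul]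
    rw [hzdef, ← pow_two, this]
  rw [← hac2.eq, ← hzdef] at h2
  rw [← hzdef] at h1
  have k1 := half_lem a z d hz hza h1
  have k2 := half_lem c z d hz hzc h2
  have hzc2 : z * c ^ 2 = c ^ 2 * z := (hzc.pow_right 2).eq
  have hdz : d * z = z * d := by
    calc d * z = (d * a ^ 2) * c ^ 2 := by rw [hzdef, mul_assoc]
      _ = a ^ 2 * z * d * (z * c ^ 2) := by rw [k1]; simp only [mul_assoc]
      _ = a ^ 2 * z * (d * c ^ 2) * z := by rw [hzc2]; simp only [mul_assoc]
      _ = a ^ 2 * (z * c ^ 2) * z * d * (z * z) := by rw [k2]; simp only [mul_assoc]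
      _ = a ^ 2 * (c ^ 2 * z) * z * d * 1 := by rw [hzc2, hz]
      _ = (a ^ 2 * c ^ 2) * (z * z) * d := by simp only [mul_assoc, mul_one]
      _ = z * d := by rw [hz, ← hzdef, mul_one]
  have r1 : Commute (a ^ 2) d := by
    have : z * d * z = d := by rw [← hdz, mul_assoc, hz, mul_one]
    rw [this] at k1
    exact k1.symm
  refine ⟨r1, ?_⟩
  have hzi : z⁻¹ = z := inv_eq_of_mul_eq_one_left hz
  have h3 : a⁻¹ * d⁻¹ * a = z * d := by
    apply mul_right_cancel (b := d)
    rw [h1, pow_two, mul_assoc]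
  have h4 : a⁻¹ * (d ^ 2)⁻¹ * a = d ^ 2 := by
    calc a⁻¹ * (d ^ 2)⁻¹ * a = (a⁻¹ * d⁻¹ * a) * (a⁻¹ * d⁻¹ * a) := by group
      _ = z * (d * z) * d := by rw [h3]; simp only [mul_assoc]
      _ = (z * z) * (d * d) := by rw [hdz]; simp only [mul_assoc]
      _ = d ^ 2 := by rw [hz, one_mul, pow_two]
  have h5 : (d ^ 2)⁻¹ = d ^ 2 := by
    apply inv_eq_of_mul_eq_one_left
    rw [← pow_add]; exact hd
  rw [h5] at h4
  show d ^ 2 * a = a * d ^ 2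
  calc d ^ 2 * a = a * (a⁻¹ * d ^ 2 * a) := by group
    _ = _ := by rw [h4]

lemma comm_of_closure {G : Type*} [Group G] (s : Set G) (hs : Subgroup.closure s = ⊤)
    (h : ∀ x ∈ s, ∀ y ∈ s, x * y = y * x) (x y : G) : x * y = y * x := by
  have h1 : Subgroup.closure s ≤ Subgroup.centralizer s := by
    rw [Subgroup.closure_le]
    intro x hx
    rw [SetLike.mem_coe, Subgroup.mem_centralizer_iff]
    intro y hy
    exact h y hy x hx
  have h2 : Subgroup.closure s ≤ Subgroup.centralizer ({x} : Set G) := by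
    rw [Subgroup.closure_le]
    intro w hw
    rw [SetLike.mem_coe, Subgroup.mem_centralizer_iff]
    intro y hy
    rw [Set.mem_singleton_iff] at hy
    subst hy
    have := h1 (hs ▸ Subgroup.mem_top y)
    rw [Subgroup.mem_centralizer_iff] at this
    exact (this w hw).symm
  have := h2 (hs ▸ Subgroup.mem_top y)
  rw [Subgroup.mem_centralizer_iff] at this
  exact this x rfl

/-! ### The relations in `P_n` -/

/-- the generator with natural index -/
def pb (n : ℕ) (i : ℕ) : Pn n :=
  if h : i < n + 2 then PresentedGroup.of ⟨i, h⟩ else 1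

lemma pb_eq (n i : ℕ) (h : i < n + 2) : pb n i = PresentedGroup.of ⟨i, h⟩ := dif_pos h

lemma pb_zero (n : ℕ) : pb n 0 = PresentedGroup.of 0 := pb_eq n 0 (by omega)

lemma rel_x (n : ℕ) : pb n 0 ^ 4 = 1 := by
  rw [pb_zero]
  exact PresentedGroup.one_of_mem (rels := pnRels n) (Or.inl (Or.inl (Or.inl rfl)))

lemma rel_b (n i : ℕ) (h : 1 ≤ i ∧ i ≤ n + 1) : pb n i ^ 4 = 1 := by
  rw [pb_eq n i (by omega)]
  exact PresentedGroup.one_of_mem (rels := pnRels n) (Or.inl (Or.inl (Or.inr ⟨i, h, rfl⟩)))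

lemma rel_xb (n i : ℕ) (h : 1 ≤ i ∧ i ≤ n + 1) :
    (pb n 0)⁻¹ * (pb n i)⁻¹ * pb n 0 * pb n i = pb n i ^ 2 := by
  rw [pb_eq n i (by omega), pb_zero]
  rw [← mul_inv_eq_one]
  exact PresentedGroup.one_of_mem (rels := pnRels n) (Or.inl (Or.inr ⟨i, h, rfl⟩))

lemma rel_bb (n i j : ℕ) (h : 1 ≤ i ∧ i < j ∧ j ≤ n + 1) :
    (pb n i)⁻¹ * (pb n j)⁻¹ * pb n i * pb n j = pb n i ^ 2 * pb n (j - i) ^ 2 * pb n j ^ 2 := by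
  rw [pb_eq n i (by omega), pb_eq n j (by omega), pb_eq n (j - i) (by omega)]
  rw [← mul_inv_eq_one]
  exact PresentedGroup.one_of_mem (rels := pnRels n) (Or.inr ⟨i, j, h, rfl⟩)

lemma sq_comm (n : ℕ) : ∀ j i : ℕ, 1 ≤ i → i < j → j ≤ n + 1 →
    Commute (pb n i ^ 2) (pb n j) ∧ Commute (pb n j ^ 2) (pb n i) := by
  intro j
  induction j using Nat.strong_induction_on with
  | _ j ih =>
    intro i hi hij hj
    have hh : Commute (pb n i ^ 2) (pb n (j - i)) ∧ Commute (pb n (j - i) ^ 2) (pb n i) := by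
      rcases lt_trichotomy i (j - i) with h | h | h
      · exact ih (j - i) (by omega) i hi h (by omega)
      · rw [← h]
        exact ⟨(Commute.refl _).pow_left 2, (Commute.refl _).pow_left 2⟩
      · exact (ih i hij (j - i) (by omega) h (by omega)).symm
    have r2 := rel_bb n (j - i) j (by omega)
    rw [show j - (j - i) = i by omega] at r2
    exact key_lem _ (pb n (j - i)) _ (rel_b n i (by omega)) (rel_b n _ (by omega))
      (rel_b n j (by omega)) hh.1 hh.2 (rel_bb n i j (by omega)) r2

lemma sq_comm_x (n i : ℕ) (h : 1 ≤ i ∧ i ≤ n + 1) : Commute (pb n i ^ 2) (pb n 0) := by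
  have h1 := rel_xb n i h
  have h2 : (pb n 0)⁻¹ * (pb n i)⁻¹ * pb n 0 = pb n i := by
    apply mul_right_cancel (b := pb n i)
    rw [h1, pow_two]
  have h3 : (pb n i ^ 2)⁻¹ = pb n i ^ 2 := by
    apply inv_eq_of_mul_eq_one_left
    rw [← pow_add]; exact rel_b n i h
  have h4 : (pb n 0)⁻¹ * (pb n i ^ 2)⁻¹ * pb n 0 = pb n i ^ 2 := by
    calc _ = ((pb n 0)⁻¹ * (pb n i)⁻¹ * pb n 0) * ((pb n 0)⁻¹ * (pb n i)⁻¹ * pb n 0) := by group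
      _ = _ := by rw [h2, pow_two]
  rw [h3] at h4
  show pb n i ^ 2 * pb n 0 = pb n 0 * pb n i ^ 2
  calc _ = pb n 0 * ((pb n 0)⁻¹ * pb n i ^ 2 * pb n 0) := by group
    _ = _ := by rw [h4]

lemma sq_comm_all (n i j : ℕ) (h : 1 ≤ i ∧ i ≤ n + 1) (hj : j < n + 2) :
    Commute (pb n i ^ 2) (pb n j) := by
  rcases Nat.eq_zero_or_pos j with rfl | h0
  · exact sq_comm_x n i h
  rcases lt_trichotomy i j with h1 | h1 | h1
  · exact (sq_comm n j i (by omega) h1 (by omega)).1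
  · rw [← h1]
    exact (Commute.refl _).pow_left 2
  · exact (sq_comm n i j (by omega) h1 (by omega)).2

lemma sq_center (n i : ℕ) (h : 1 ≤ i ∧ i ≤ n + 1) : pb n i ^ 2 ∈ Subgroup.center (Pn n) := by
  have h1 : Subgroup.closure (Set.range (PresentedGroup.of (rels := pnRels n))) ≤
      Subgroup.centralizer {pb n i ^ 2} := by
    rw [Subgroup.closure_le]
    rintro _ ⟨j, rfl⟩
    rw [SetLike.mem_coe, Subgroup.mem_centralizer_iff]
    rintro y hy
    rw [Set.mem_singleton_iff] at hy
    subst hy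
    have := sq_comm_all n i j h j.2
    rw [pb_eq n j j.2] at this
    exact this.eq
  rw [PresentedGroup.closure_range_of] at h1
  rw [Subgroup.mem_center_iff]
  intro g
  have := h1 (Subgroup.mem_top g)
  rw [Subgroup.mem_centralizer_iff] at this
  exact (this _ rfl).symm

lemma sqB_eq (n : ℕ) : pnSqB n = {g | ∃ i, (1 ≤ i ∧ i ≤ n + 1) ∧ g = pb n i ^ 2} := by
  ext g
  constructor
  · rintro ⟨i, h, rfl⟩
    exact ⟨i, h, by rw [pb_eq n i (by omega)]⟩
  · rintro ⟨i, h, rfl⟩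
    exact ⟨i, h, by rw [pb_eq n i (by omega)]⟩

lemma clos_center (n : ℕ) : Subgroup.closure (pnSqB n) ≤ Subgroup.center (Pn n) := by
  rw [sqB_eq, Subgroup.closure_le]
  rintro _ ⟨i, h, rfl⟩
  exact sq_center n i h

lemma sq_mem_clos (n i : ℕ) (h : 1 ≤ i ∧ i ≤ n + 1) :
    pb n i ^ 2 ∈ Subgroup.closure (pnSqB n) := by
  apply Subgroup.subset_closure
  rw [sqB_eq]
  exact ⟨i, h, rfl⟩

lemma comm_mem_clos (n i j : ℕ) (hij : i < j) (hj : j < n + 2) :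
    (pb n i)⁻¹ * (pb n j)⁻¹ * pb n i * pb n j ∈ Subgroup.closure (pnSqB n) := by
  rcases Nat.eq_zero_or_pos i with rfl | h0
  · rw [rel_xb n j (by omega)]
    exact sq_mem_clos n j (by omega)
  · rw [rel_bb n i j (by omega)]
    exact mul_mem (mul_mem (sq_mem_clos n _ (by omega)) (sq_mem_clos n _ (by omega)))
      (sq_mem_clos n _ (by omega))

lemma commutator_eq (n : ℕ) : commutator (Pn n) = Subgroup.closure (pnSqB n) := by
  apply le_antisymm
  · have hN : (Subgroup.closure (pnSqB n)).Normal := by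
      constructor
      intro a ha g
      have := Subgroup.mem_center_iff.1 (clos_center n ha) g
      rw [this, mul_inv_cancel_right]
      exact ha
    rw [← Subgroup.Normal.quotient_commutative_iff_commutator_le]
    have key : ∀ x y : Pn n ⧸ Subgroup.closure (pnSqB n), x * y = y * x := by
      apply comm_of_closure (Set.range fun i : Fin (n + 2) =>
        QuotientGroup.mk' (Subgroup.closure (pnSqB n)) (pb n i))
      · have : (Set.range fun i : Fin (n + 2) =>
          QuotientGroup.mk' (Subgroup.closure (pnSqB n)) (pb n i)) =
          (QuotientGroup.mk' (Subgroup.closure (pnSqB n))) ''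
            (Set.range (PresentedGroup.of (rels := pnRels n))) := by
          rw [← Set.range_comp]
          congr 1
          funext i
          simp only [Function.comp]
          rw [pb_eq n i i.2]
        rw [this, ← MonoidHom.map_closure, PresentedGroup.closure_range_of,
          ← MonoidHom.range_eq_map, MonoidHom.range_eq_top]
        exact QuotientGroup.mk'_surjective _
      · have aux : ∀ i j : Fin (n + 2), i < j →
          QuotientGroup.mk' (Subgroup.closure (pnSqB n)) (pb n i) *
          QuotientGroup.mk' (Subgroup.closure (pnSqB n)) (pb n j) =
          QuotientGroup.mk' (Subgroup.closure (pnSqB n)) (pb n j) *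
          QuotientGroup.mk' (Subgroup.closure (pnSqB n)) (pb n i) := by
          intro i j hij
          rw [← map_mul, ← map_mul, eq_comm]
          apply QuotientGroup.eq.2
          have := comm_mem_clos n i j hij j.2
          simpa only [mul_inv_rev, mul_assoc] using this
        rintro _ ⟨i, rfl⟩ _ ⟨j, rfl⟩
        rcases lt_trichotomy i j with h | h | h
        · exact aux i j h
        · rw [h]
        · exact (aux j i h).symm
    exact ⟨⟨key⟩⟩
  · rw [sqB_eq, Subgroup.closure_le]
    rintro _ ⟨i, h, rfl⟩
    rw [← rel_xb n i h]
    have := Subgroup.commutator_mem_commutator (Subgroup.mem_top (pb n 0)⁻¹)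
      (Subgroup.mem_top (pb n i)⁻¹)
    rw [commutatorElement_def, inv_inv, inv_inv] at this
    exact this

/-! ### The model -/

/-- Central extension of `A` by `V` with bilinear cocycle `f`. -/
@[ext] structure CExt {A V : Type} [AddCommGroup A] [AddCommGroup V] (f : A →+ A →+ V) where
  fst : A
  snd : V

namespace CExt
variable {A V : Type} [AddCommGroup A] [AddCommGroup V] {f : A →+ A →+ V}

instance : Mul (CExt f) := ⟨fun a b => ⟨a.1 + b.1, a.2 + b.2 + f a.1 b.1⟩⟩
instance : One (CExt f) := ⟨⟨0, 0⟩⟩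
instance : Inv (CExt f) := ⟨fun a => ⟨-a.1, -a.2 + f a.1 a.1⟩⟩

@[simp] lemma mul_fst (a b : CExt f) : (a * b).1 = a.1 + b.1 := rfl
@[simp] lemma mul_snd (a b : CExt f) : (a * b).2 = a.2 + b.2 + f a.1 b.1 := rfl
@[simp] lemma one_fst : (1 : CExt f).1 = 0 := rfl
@[simp] lemma one_snd : (1 : CExt f).2 = 0 := rfl
@[simp] lemma inv_fst (a : CExt f) : (a⁻¹).1 = -a.1 := rfl
@[simp] lemma inv_snd (a : CExt f) : (a⁻¹).2 = -a.2 + f a.1 a.1 := rfl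

instance : Group (CExt f) := Group.ofLeftAxioms
  (by intro a b c; ext <;> simp <;> abel)
  (by intro a; ext <;> simp)
  (by intro a; ext <;> simp)

/-- projection -/
def proj : CExt f →* Multiplicative A where
  toFun a := Multiplicative.ofAdd a.1
  map_one' := rfl
  map_mul' _ _ := rfl

/-- inclusion -/
def incl : Multiplicative V →* CExt f where
  toFun v := ⟨0, v.toAdd⟩
  map_one' := rfl
  map_mul' a b := by ext <;> simp

end CExt

/-- abbreviations -/
abbrev VV (n : ℕ) : Type := Fin (n + 1) → ZMod 2
abbrev AA (n : ℕ) : Type := ZMod 4 × VV n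

def sg (n : ℕ) (i : Fin (n + 1)) : VV n := Pi.single i 1

lemma VV_add_self {n : ℕ} (v : VV n) : v + v = 0 := by
  funext i
  exact CharTwo.add_self_eq_zero (v i)

def coc (n : ℕ) (i j : Fin (n + 1)) : VV n :=
  if i = j then sg n i else if i < j then
    sg n i + sg n ⟨j - i - 1, by omega⟩ + sg n j else 0

def FF (n : ℕ) : AA n →+ AA n →+ VV n :=
  AddMonoidHom.mk' (fun a => AddMonoidHom.mk' (fun b =>
    (ZMod.castHom (show 2 ∣ 4 by decide) (ZMod 2) a.1) • b.2 +
      ∑ i, ∑ j, (a.2 i * b.2 j) • coc n i j)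
    (by
      intro b b'
      simp only [Prod.snd_add, Pi.add_apply, mul_add, add_smul, Finset.sum_add_distrib, smul_add]
      abel))
    (by
      intro a a'
      ext1 b
      simp only [AddMonoidHom.mk'_apply, AddMonoidHom.add_apply, Prod.fst_add, map_add,
        Prod.snd_add, Pi.add_apply, add_mul, add_smul, Finset.sum_add_distrib]
      abel)

lemma FF_apply (n : ℕ) (a b : AA n) : FF n a b =
    (ZMod.castHom (show 2 ∣ 4 by decide) (ZMod 2) a.1) • b.2 +
      ∑ i, ∑ j, (a.2 i * b.2 j) • coc n i j := rfl

def ax (n : ℕ) : AA n := (1, 0)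
def ab (n : ℕ) (i : Fin (n + 1)) : AA n := (0, sg n i)

lemma FF_xx (n : ℕ) : FF n (ax n) (ax n) = 0 := by
  rw [FF_apply]; simp [ax]
lemma FF_xb (n : ℕ) (i) : FF n (ax n) (ab n i) = sg n i := by
  rw [FF_apply]; simp only [ax, ab, map_one, one_smul]; simp
lemma FF_bx (n : ℕ) (i) : FF n (ab n i) (ax n) = 0 := by
  rw [FF_apply]; simp [ax, ab]
lemma FF_bb (n : ℕ) (i j) : FF n (ab n i) (ab n j) = coc n i j := by
  rw [FF_apply]; simp only [ab, map_zero, zero_smul, zero_add]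
  rw [Finset.sum_eq_single i, Finset.sum_eq_single j]
  · simp [sg]
  · intro k _ hk; simp [sg, hk]
  · simp
  · intro k _ hk; simp [sg, hk]
  · simp

lemma ab_add_self (n : ℕ) (i) : ab n i + ab n i = 0 := by
  simp only [ab, Prod.mk_add_mk, VV_add_self, add_zero]; rfl

lemma ax4 (n : ℕ) : ax n + ax n + (ax n + ax n) = 0 := by
  simp only [ax, Prod.mk_add_mk, add_zero]
  exact Prod.ext (show (1 : ZMod 4) + 1 + (1 + 1) = 0 by decide) rfl

def gx (n : ℕ) : CExt (FF n) := ⟨ax n, 0⟩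
def gb (n : ℕ) (i : Fin (n + 1)) : CExt (FF n) := ⟨ab n i, 0⟩

lemma gb_sq (n : ℕ) (i) : gb n i ^ 2 = ⟨0, sg n i⟩ := by
  rw [pow_two]
  ext1
  · exact ab_add_self n i
  · simp [gb, FF_bb, coc]

lemma gb_four (n : ℕ) (i) : gb n i ^ 4 = 1 := by
  have e : gb n i ^ 4 = (gb n i ^ 2) ^ 2 := by rw [← pow_mul]
  rw [e, gb_sq, pow_two]
  ext1
  · simp
  · simp [VV_add_self]

lemma gx_four (n : ℕ) : gx n ^ 4 = 1 := by
  have e : gx n ^ 4 = (gx n ^ 2) ^ 2 := by rw [← pow_mul]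
  rw [e, pow_two, pow_two]
  ext1
  · simpa [gx] using ax4 n
  · simp [gx, FF_xx]

lemma br_of {G : Type*} [Group G] (a b w : G) (h : a * b = b * a * w) : br a b * w⁻¹ = 1 := by
  rw [mul_inv_eq_one, br]
  calc a⁻¹ * b⁻¹ * a * b = a⁻¹ * b⁻¹ * (a * b) := by group
    _ = w := by rw [h]; group

lemma g_xb (n : ℕ) (i) : gx n * gb n i = gb n i * gx n * gb n i ^ 2 := by
  rw [gb_sq]
  ext1
  · simp [gx, gb, add_comm]
  · simp [gx, gb, FF_xb, FF_bx]

lemma g_bb (n : ℕ) (i j : Fin (n + 1)) (h : i < j) : gb n i * gb n j =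
    gb n j * gb n i * (gb n i ^ 2 * gb n ⟨j - i - 1, by omega⟩ ^ 2 * gb n j ^ 2) := by
  rw [gb_sq, gb_sq, gb_sq]
  ext1
  · simp [gb, add_comm]
  · simp [gb, FF_bb, coc, h.ne, h.ne', h, h.not_gt]

def gen (n : ℕ) : Fin (n + 2) → CExt (FF n) := Fin.cases (gx n) (gb n)

lemma gen_zero (n : ℕ) : gen n 0 = gx n := rfl
lemma gen_succ (n i : ℕ) (h : i + 1 < n + 2) : gen n ⟨i + 1, h⟩ = gb n ⟨i, by omega⟩ := rfl

lemma gen_rels (n : ℕ) : ∀ r ∈ pnRels n, FreeGroup.lift (gen n) r = 1 := by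
  rintro r (((hr | ⟨i, h, rfl⟩) | ⟨i, h, rfl⟩) | ⟨i, j, h, rfl⟩)
  · rw [Set.mem_singleton_iff] at hr
    subst hr
    rw [map_pow, FreeGroup.lift_apply_of, gen_zero, gx_four]
  · obtain ⟨i, rfl⟩ : ∃ k, i = k + 1 := ⟨i - 1, by omega⟩
    rw [map_pow, FreeGroup.lift_apply_of, gen_succ, gb_four]
  · obtain ⟨i, rfl⟩ : ∃ k, i = k + 1 := ⟨i - 1, by omega⟩
    have := br_of _ _ _ (g_xb n ⟨i, by omega⟩)
    simpa only [br, map_mul, map_inv, map_pow, FreeGroup.lift_apply_of, gen_succ, gen_zero]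
      using this
  · obtain ⟨p, rfl⟩ : ∃ k, i = k + 1 := ⟨i - 1, by omega⟩
    obtain ⟨q, rfl⟩ : ∃ k, j = k + 1 := ⟨j - 1, by omega⟩
    have e : (⟨q + 1 - (p + 1), by omega⟩ : Fin (n + 2)) = ⟨(q - p - 1) + 1, by omega⟩ :=
      Fin.ext (show q + 1 - (p + 1) = (q - p - 1) + 1 by omega)
    have := br_of _ _ _ (g_bb n ⟨p, by omega⟩ ⟨q, by omega⟩
      (show p < q by omega))
    rw [e]
    simpa only [br, map_mul, map_inv, map_pow, FreeGroup.lift_apply_of, gen_succ, gen_zero]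
      using this

/-- The map to the model. -/
def phi (n : ℕ) : Pn n →* CExt (FF n) := PresentedGroup.toGroup (gen_rels n)

lemma phi_zero (n : ℕ) : phi n (pb n 0) = gx n := by
  rw [pb_zero]; exact PresentedGroup.toGroup.of _

lemma phi_succ (n : ℕ) (i : Fin (n + 1)) : phi n (pb n (i + 1)) = gb n i := by
  rw [pb_eq n _ (by omega)]; exact PresentedGroup.toGroup.of _

/-! ### homs out of elementary abelian groups -/

lemma VV_top (n : ℕ) (K : AddSubgroup (VV n)) (h : ∀ i, sg n i ∈ K) (v : VV n) : v ∈ K := by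
  rw [← Finset.univ_sum_single v]
  refine sum_mem fun i _ => ?_
  have : v i = 0 ∨ v i = 1 := by
    generalize v i = t
    revert t; decide
  rcases this with h0 | h0
  · rw [h0, Pi.single_zero]; exact zero_mem K
  · rw [h0]; exact h i

def zl (m : ℕ) {C : Type} [AddCommGroup C] (c : C) (h : m • c = 0) : ZMod m →+ C :=
  ZMod.lift m ⟨zmultiplesHom C c, by simpa using h⟩

lemma zl_one (m : ℕ) {C : Type} [AddCommGroup C] (c : C) (h : m • c = 0) : zl m c h 1 = c := by
  have := ZMod.lift_coe m ⟨zmultiplesHom C c, by simpa using h⟩ 1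
  simpa [zl] using this

def vlift (n : ℕ) {C : Type} [AddCommGroup C] (c : Fin (n + 1) → C) (h : ∀ i, 2 • c i = 0) :
    VV n →+ C :=
  ∑ i, (zl 2 (c i) (h i)).comp (Pi.evalAddMonoidHom _ i)

lemma vlift_sg (n : ℕ) {C : Type} [AddCommGroup C] (c : Fin (n + 1) → C)
    (h : ∀ i, 2 • c i = 0) (i) : vlift n c h (sg n i) = c i := by
  rw [vlift, AddMonoidHom.finsetSum_apply, Finset.sum_eq_single i]
  · simp [sg, zl_one]
  · intro j _ hj
    simp [sg, hj]
  · simp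

instance centerCG (n : ℕ) : CommGroup (Subgroup.center (Pn n)) :=
  { (inferInstance : Group (Subgroup.center (Pn n))) with
    mul_comm := fun a b => Subtype.ext (Subgroup.mem_center_iff.1 b.2 a) }

def sqc (n : ℕ) (i : Fin (n + 1)) : Additive (Subgroup.center (Pn n)) :=
  Additive.ofMul ⟨pb n (i + 1) ^ 2, sq_center n _ (by omega)⟩

lemma sqc_two (n : ℕ) (i : Fin (n + 1)) : 2 • sqc n i = 0 := by
  rw [two_nsmul]
  have : (⟨pb n (i + 1) ^ 2, sq_center n _ (by omega)⟩ : Subgroup.center (Pn n)) *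
      ⟨pb n (i + 1) ^ 2, sq_center n _ (by omega)⟩ = 1 := by
    apply Subtype.ext
    show pb n (i + 1) ^ 2 * pb n (i + 1) ^ 2 = 1
    rw [← pow_add]; exact rel_b n _ (by omega)
  exact this

/-- from `V` to the center -/
def theta0 (n : ℕ) : VV n →+ Additive (Subgroup.center (Pn n)) :=
  vlift n (sqc n) (sqc_two n)

def theta (n : ℕ) : Multiplicative (VV n) →* Pn n :=
  (Subgroup.center (Pn n)).subtype.comp (AddMonoidHom.toMultiplicativeLeft (theta0 n))

lemma theta_sg (n : ℕ) (i : Fin (n + 1)) :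
    theta n (Multiplicative.ofAdd (sg n i)) = pb n (i + 1) ^ 2 := by
  have := vlift_sg n (sqc n) (sqc_two n) i
  exact congrArg (fun z : Additive (Subgroup.center (Pn n)) => ((Additive.toMul z : Subgroup.center (Pn n)) : Pn n)) this

lemma mVV_top (n : ℕ) (K : Subgroup (Multiplicative (VV n)))
    (h : ∀ i, Multiplicative.ofAdd (sg n i) ∈ K) (v) : v ∈ K :=
  VV_top n (Subgroup.toAddSubgroup' K) h v

lemma theta_inj (n : ℕ) : Function.Injective (theta n) := by
  have h : (phi n).comp (theta n) = CExt.incl := by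
    refine MonoidHom.ext fun v => ?_
    refine mVV_top n (MonoidHom.eqLocus ((phi n).comp (theta n)) CExt.incl) ?_ v
    intro i
    show phi n (theta n _) = _
    rw [theta_sg, map_pow, phi_succ, gb_sq]
    rfl
  have h2 : Function.Injective (CExt.incl (f := FF n)) := by
    intro a b hab
    exact congrArg CExt.snd hab
  rw [← h] at h2
  exact Function.Injective.of_comp (f := phi n) h2

lemma theta_range (n : ℕ) : (theta n).range = Subgroup.closure (pnSqB n) := by
  apply le_antisymm
  · rintro _ ⟨v, rfl⟩
    refine mVV_top n ((Subgroup.closure (pnSqB n)).comap (theta n)) ?_ v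
    intro i
    rw [Subgroup.mem_comap, theta_sg]
    exact sq_mem_clos n _ (by omega)
  · rw [sqB_eq, Subgroup.closure_le]
    rintro _ ⟨i, h, rfl⟩
    obtain ⟨i, rfl⟩ : ∃ k, i = k + 1 := ⟨i - 1, by omega⟩
    exact ⟨_, theta_sg n ⟨i, by omega⟩⟩

/-! ### abelianization -/

def alpha (n : ℕ) : Abelianization (Pn n) →* Multiplicative (AA n) :=
  Abelianization.lift (CExt.proj.comp (phi n))

lemma ab_sq (n : ℕ) (i : Fin (n + 1)) :
    2 • (Additive.ofMul (Abelianization.of (pb n (i + 1)))) = 0 := by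
  rw [← ofMul_pow, ← map_pow, ← rel_xb n _ (by omega)]
  simp only [map_mul, map_inv]
  rw [mul_right_comm _ _ (Abelianization.of (pb n 0)), inv_mul_cancel, one_mul, inv_mul_cancel]
  rfl

def beta0 (n : ℕ) : AA n →+ Additive (Abelianization (Pn n)) :=
  (zl 4 (Additive.ofMul (Abelianization.of (pb n 0))) (by
    rw [← ofMul_pow, ← map_pow, rel_x, map_one]; rfl)).coprod
  (vlift n (fun i => Additive.ofMul (Abelianization.of (pb n (i + 1)))) (ab_sq n))

lemma beta0_x (n : ℕ) : beta0 n (ax n) = Additive.ofMul (Abelianization.of (pb n 0)) := by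
  simp only [beta0, ax, AddMonoidHom.coprod_apply, map_zero, add_zero, zl_one]

lemma beta0_b (n : ℕ) (i : Fin (n + 1)) :
    beta0 n (ab n i) = Additive.ofMul (Abelianization.of (pb n (i + 1))) := by
  simp only [beta0, ab, AddMonoidHom.coprod_apply, map_zero, zero_add, vlift_sg]

def beta (n : ℕ) : Multiplicative (AA n) →* Abelianization (Pn n) :=
  AddMonoidHom.toMultiplicativeLeft (beta0 n)

lemma beta_alpha (n : ℕ) : (beta n).comp (alpha n) = MonoidHom.id _ := by
  apply Abelianization.hom_ext
  apply PresentedGroup.ext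
  intro i
  have hi : PresentedGroup.of i = pb n i := (pb_eq n i i.2).symm
  rw [hi]
  show beta n (CExt.proj (phi n (pb n i))) = Abelianization.of (pb n i)
  obtain ⟨i, h⟩ := i
  rcases i with _ | i
  · show beta n (CExt.proj (phi n (pb n 0))) = Abelianization.of (pb n 0)
    rw [phi_zero]
    exact beta0_x n
  · show beta n (CExt.proj (phi n (pb n (i + 1)))) = Abelianization.of (pb n (i + 1))
    rw [phi_succ n ⟨i, by omega⟩]
    exact beta0_b n ⟨i, by omega⟩

lemma alpha_surj (n : ℕ) : Function.Surjective (alpha n) := by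
  have hx : Multiplicative.ofAdd (ax n) ∈ (alpha n).range := by
    refine ⟨Abelianization.of (pb n 0), ?_⟩
    show CExt.proj (phi n (pb n 0)) = _
    rw [phi_zero]; rfl
  have hb : ∀ i, Multiplicative.ofAdd (ab n i) ∈ (alpha n).range := by
    intro i
    refine ⟨Abelianization.of (pb n (i + 1)), ?_⟩
    show CExt.proj (phi n (pb n (i + 1))) = _
    rw [phi_succ]; rfl
  let K : AddSubgroup (AA n) := Subgroup.toAddSubgroup' (alpha n).range
  have hx' : ax n ∈ K := hx
  have hb' : ∀ v : VV n, ((0 : ZMod 4), v) ∈ K :=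
    VV_top n (K.comap (AddMonoidHom.inr (ZMod 4) (VV n))) hb
  intro a
  show a ∈ (alpha n).range
  have : ((Multiplicative.toAdd a) : AA n) ∈ K := by
    generalize (Multiplicative.toAdd a : AA n) = a
    obtain ⟨s, v⟩ := a
    have e : ((s, v) : AA n) = s.val • ax n + (0, v) := by
      refine Prod.ext ?_ ?_
      · simp [ax]
      · simp [ax]
    rw [e]
    exact add_mem (nsmul_mem hx' _) (hb' v)
  exact this

/-- **Theorem A.4.** The derived subgroup of `P_n` is generated by `b₁², …, b_{n+1}²`;
it is elementary abelian of order `2^{n+1}`, it is contained in the center (so `P_n` is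
nilpotent of class at most 2), and the abelianization of `P_n` is isomorphic to
`ℤ/4ℤ × (ℤ/2ℤ)^{n+1}`. -/
theorem statement13 (n : ℕ) :
    commutator (Pn n) = Subgroup.closure (pnSqB n) ∧
      Nonempty (commutator (Pn n) ≃* Multiplicative (Fin (n + 1) → ZMod 2)) ∧
      commutator (Pn n) ≤ Subgroup.center (Pn n) ∧
      Nonempty (Abelianization (Pn n) ≃*
        Multiplicative (ZMod 4 × (Fin (n + 1) → ZMod 2))) := by
  refine ⟨commutator_eq n, ?_, ?_, ?_⟩
  · exact ⟨((MonoidHom.ofInjective (theta_inj n)).trans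
      (MulEquiv.subgroupCongr ((theta_range n).trans (commutator_eq n).symm))).symm⟩
  · rw [commutator_eq]
    exact clos_center n
  · refine ⟨MulEquiv.ofBijective (alpha n) ⟨?_, alpha_surj n⟩⟩
    intro a b hab
    have h := congrArg (beta n) hab
    have e := DFunLike.congr_fun (beta_alpha n)
    exact (e a).symm.trans (h.trans (e b))
end
end
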